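/- Let A be a positive semidefinite matrix whose rows and columns are indexed by a triple product I×J×K of finite index sets (an operator on ℂ^I ⊗ ℂ^J ⊗ ℂ^K). Let Tr_1 A be the partial trace over the I factor (a matrix indexed by J×K), and for a matrix M indexed by J×K let Tr_J M denote its partial trace over the J factor (a matrix indexed by K); similarly, for a matrix N indexed by I×J×K let Tr_J N denote its partial trace over the J factor (a matrix indexed by I×K). Then Tr((Tr_J((Tr_1 A)^2))^{1/2}) ≤ Tr((Tr_J(A^2))^{1/2}), where the outer traces are the ordinary traces on ℂ^K and on ℂ^I ⊗ ℂ^K respectively. -/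

import Mathlib

open Matrix
open scoped ComplexOrder

/-- Matrix power via the functional calculus: for a Hermitian matrix, apply the real
power `x ^ s` to the eigenvalues in its spectral decomposition (so `0 ^ s = 0` for `s > 0`);
junk value `0` for non-Hermitian matrices. -/
noncomputable def matrixRpow {n : Type*} [Fintype n] [DecidableEq n]
    (A : Matrix n n ℂ) (s : ℝ) : Matrix n n ℂ :=
  if h : A.IsHermitian then
    (h.eigenvectorUnitary : Matrix n n ℂ) *
      Matrix.diagonal (fun i => ((h.eigenvalues i ^ s : ℝ) : ℂ)) *
        (star h.eigenvectorUnitary : Matrix n n ℂ)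
  else 0

/-- Partial trace over the first factor: `(Tr₁ A)(j,j') = ∑ i, A((i,j),(i,j'))`. -/
noncomputable def ptraceFst {I J : Type*} [Fintype I]
    (A : Matrix (I × J) (I × J) ℂ) : Matrix J J ℂ :=
  Matrix.of fun j j' => ∑ i, A (i, j) (i, j')

/-- Partial trace over the middle factor of a triple product:
`(Tr_J A)((i,k),(i',k')) = ∑ j, A((i,j,k),(i',j,k'))`. -/
noncomputable def ptraceMid {I J K : Type*} [Fintype J]
    (A : Matrix (I × J × K) (I × J × K) ℂ) : Matrix (I × K) (I × K) ℂ :=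
  Matrix.of fun p q => ∑ j, A (p.1, j, p.2) (q.1, j, q.2)

open scoped Kronecker

theorem conjTranspose_mul_self_apply_self {m n : Type*} [Fintype m]
    (M : Matrix m n ℂ) (a : n) :
    (Mᴴ * M) a a = ((∑ x, ‖M x a‖ ^ 2 : ℝ) : ℂ) := by
  simp [Matrix.mul_apply, Complex.conj_mul']

section TraceNorm

variable {m n : Type*} [Fintype m] [Fintype n] [DecidableEq n]

theorem Matrix.IsHermitian.eq_eigenvectorUnitary_mul_diagonal {X : Matrix n n ℂ}
    (h : X.IsHermitian) :
    X = (h.eigenvectorUnitary : Matrix n n ℂ) *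
      diagonal (fun i => ((h.eigenvalues i : ℝ) : ℂ)) *
        (star h.eigenvectorUnitary : Matrix n n ℂ) := by
  conv_lhs => rw [h.spectral_theorem, Unitary.conjStarAlgAut_apply]
  rfl

theorem matrixRpow_two {X : Matrix n n ℂ} (h : X.IsHermitian) :
    matrixRpow X 2 = Xᴴ * X := by
  have hU : (star h.eigenvectorUnitary : Matrix n n ℂ) *
      (h.eigenvectorUnitary : Matrix n n ℂ) = 1 :=
    Unitary.coe_star_mul_self _
  rw [h.eq, matrixRpow, dif_pos h]
  conv_rhs => rw [h.eq_eigenvectorUnitary_mul_diagonal]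
  generalize (h.eigenvectorUnitary : Matrix n n ℂ) = U at hU ⊢
  calc _ = U * (diagonal (fun i => ((h.eigenvalues i : ℝ) : ℂ)) *
        diagonal (fun i => ((h.eigenvalues i : ℝ) : ℂ))) * star U := by
        rw [diagonal_mul_diagonal]
        congr 3
        ext i
        rw [Real.rpow_two]
        push_cast
        ring
    _ = U * diagonal (fun i => ((h.eigenvalues i : ℝ) : ℂ)) * (star U * U) *
        diagonal (fun i => ((h.eigenvalues i : ℝ) : ℂ)) * star U := by
        rw [hU]
        simp only [Matrix.mul_assoc, Matrix.one_mul]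
    _ = _ := by simp only [Matrix.mul_assoc]

theorem trace_matrixRpow_half {X : Matrix n n ℂ} (h : X.IsHermitian) :
    (matrixRpow X (1 / 2)).trace = ((∑ i, √(h.eigenvalues i) : ℝ) : ℂ) := by
  rw [matrixRpow, dif_pos h, trace_mul_comm, ← Matrix.mul_assoc, Unitary.coe_star_mul_self,
    Matrix.one_mul, trace_diagonal]
  simp [Real.sqrt_eq_rpow]

/-- The real part of the pairing of two vectors is at most the product of their norms. -/
theorem re_sum_star_mul_le_sqrt (v c : m → ℂ) :
    (∑ x, star (v x) * c x).re ≤ √(∑ x, ‖v x‖ ^ 2) * √(∑ x, ‖c x‖ ^ 2) := by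
  have h := re_inner_le_norm (𝕜 := ℂ) (WithLp.toLp 2 v) (WithLp.toLp 2 c)
  rw [EuclideanSpace.norm_eq, EuclideanSpace.norm_eq] at h
  simpa [PiLp.inner_apply, mul_comm] using h

/-- The trace norm dominates the pairing with any contraction. -/
theorem re_trace_conjTranspose_mul_le (C V : Matrix m n ℂ) (hV : (1 - Vᴴ * V).PosSemidef) :
    (Vᴴ * C).trace.re ≤ (matrixRpow (Cᴴ * C) (1 / 2)).trace.re := by
  have h : (Cᴴ * C).IsHermitian := isHermitian_conjTranspose_mul_self C
  rw [trace_matrixRpow_half h, Complex.ofReal_re]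
  set U : Matrix n n ℂ := (h.eigenvectorUnitary : Matrix n n ℂ)
  have hU : Uᴴ * U = 1 := Unitary.coe_star_mul_self _
  have hU' : U * Uᴴ = 1 := Unitary.coe_mul_star_self _
  have hC : (C * U)ᴴ * (C * U) = diagonal (fun i => ((h.eigenvalues i : ℝ) : ℂ)) := by
    calc _ = Uᴴ * (Cᴴ * C) * U := by rw [conjTranspose_mul]; simp only [Matrix.mul_assoc]
      _ = Uᴴ * (U * diagonal (fun i => ((h.eigenvalues i : ℝ) : ℂ)) * Uᴴ) * U := by
        congr 2
        exact h.eq_eigenvectorUnitary_mul_diagonal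
      _ = (Uᴴ * U) * diagonal (fun i => ((h.eigenvalues i : ℝ) : ℂ)) * (Uᴴ * U) := by
        simp only [Matrix.mul_assoc]
      _ = _ := by rw [hU, Matrix.one_mul, Matrix.mul_one]
  have hcol (a : n) : ∑ x, ‖(C * U) x a‖ ^ 2 = h.eigenvalues a := by
    have := conjTranspose_mul_self_apply_self (C * U) a
    rw [hC, diagonal_apply_eq] at this
    exact_mod_cast this.symm
  have hVcol (a : n) : ∑ x, ‖(V * U) x a‖ ^ 2 ≤ 1 := by
    have h1 : Uᴴ * (1 - Vᴴ * V) * U = 1 - (V * U)ᴴ * (V * U) := by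
      rw [Matrix.mul_sub, Matrix.sub_mul, Matrix.mul_one, hU, conjTranspose_mul]
      simp only [Matrix.mul_assoc]
    have h2 := (hV.conjTranspose_mul_mul_same U).diag_nonneg (i := a)
    rw [h1, Matrix.sub_apply, one_apply_eq, conjTranspose_mul_self_apply_self] at h2
    have h3 : (0 : ℝ) ≤ 1 - ∑ x, ‖(V * U) x a‖ ^ 2 := by exact_mod_cast h2
    linarith
  have htr : (Vᴴ * C).trace = ∑ a, ∑ x, star ((V * U) x a) * (C * U) x a := by
    calc _ = ((V * U)ᴴ * (C * U)).trace := by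
          rw [conjTranspose_mul, Matrix.mul_assoc, trace_mul_comm Uᴴ, Matrix.mul_assoc,
            Matrix.mul_assoc, hU', Matrix.mul_one]
      _ = _ := rfl
  rw [htr, Complex.re_sum]
  refine Finset.sum_le_sum fun a _ => (re_sum_star_mul_le_sqrt _ _).trans ?_
  rw [hcol]
  exact mul_le_of_le_one_left (Real.sqrt_nonneg _) (Real.sqrt_le_one.mpr (hVcol a))

/-- The trace norm is attained by the partial isometry of the polar decomposition. -/
theorem exists_contraction_trace_eq (D : Matrix m n ℂ) :
    ∃ V : Matrix m n ℂ, (1 - Vᴴ * V).PosSemidef ∧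
      (Vᴴ * D).trace = (matrixRpow (Dᴴ * D) (1 / 2)).trace := by
  have h : (Dᴴ * D).IsHermitian := isHermitian_conjTranspose_mul_self D
  rw [trace_matrixRpow_half h]
  set U : Matrix n n ℂ := (h.eigenvectorUnitary : Matrix n n ℂ)
  have hU : Uᴴ * U = 1 := Unitary.coe_star_mul_self _
  have hU' : U * Uᴴ = 1 := Unitary.coe_mul_star_self _
  set S : Matrix n n ℂ := diagonal (fun i => (((√(h.eigenvalues i))⁻¹ : ℝ) : ℂ)) with hS
  set L : Matrix n n ℂ := diagonal (fun i => ((h.eigenvalues i : ℝ) : ℂ)) with hL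
  have hSS : Sᴴ = S := by
    rw [hS, diagonal_conjTranspose]
    congr 1
    ext i
    simp
  have hD : Dᴴ * D = U * L * Uᴴ := h.eq_eigenvectorUnitary_mul_diagonal
  have hVD : (D * U * S * Uᴴ)ᴴ * D = U * (S * L) * Uᴴ := by
    calc _ = U * S * Uᴴ * (Dᴴ * D) := by
          simp only [conjTranspose_mul, conjTranspose_conjTranspose, hSS, Matrix.mul_assoc]
      _ = U * S * (Uᴴ * U) * L * Uᴴ := by rw [hD]; simp only [Matrix.mul_assoc]
      _ = _ := by rw [hU]; simp only [Matrix.mul_assoc, Matrix.one_mul]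
  refine ⟨D * U * S * Uᴴ, ?_, ?_⟩
  · have h1 : 1 - (D * U * S * Uᴴ)ᴴ * (D * U * S * Uᴴ) = U * (1 - S * L * S) * Uᴴ := by
      have : (D * U * S * Uᴴ)ᴴ * (D * U * S * Uᴴ) = U * (S * L * S) * Uᴴ := by
        calc _ = (D * U * S * Uᴴ)ᴴ * D * (U * S * Uᴴ) := by simp only [Matrix.mul_assoc]
          _ = U * (S * L) * (Uᴴ * U) * S * Uᴴ := by rw [hVD]; simp only [Matrix.mul_assoc]
          _ = _ := by rw [hU]; simp only [Matrix.mul_assoc, Matrix.one_mul]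
      rw [this, Matrix.mul_sub, Matrix.sub_mul, Matrix.mul_one, hU']
    rw [h1]
    refine PosSemidef.mul_mul_conjTranspose_same ?_ U
    rw [hS, hL, diagonal_mul_diagonal, diagonal_mul_diagonal, ← diagonal_one, diagonal_sub,
      posSemidef_diagonal_iff]
    intro i
    have key : (√(h.eigenvalues i))⁻¹ * h.eigenvalues i * (√(h.eigenvalues i))⁻¹ ≤ 1 := by
      rw [mul_comm (√(h.eigenvalues i))⁻¹ (h.eigenvalues i), ← div_eq_mul_inv (h.eigenvalues i),
        Real.div_sqrt]
      exact mul_inv_le_one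
    have key' := sub_nonneg.mpr key
    exact_mod_cast key'
  · rw [hVD, trace_mul_comm, ← Matrix.mul_assoc, hU, Matrix.one_mul, hS, hL,
      diagonal_mul_diagonal, trace_diagonal, Complex.ofReal_sum]
    refine Finset.sum_congr rfl fun i _ => ?_
    rw [← Complex.ofReal_mul, mul_comm, ← div_eq_mul_inv, Real.div_sqrt]

end TraceNorm

/-- The trace norm does not increase under the partial trace of a rectangular matrix over a
common first factor. -/
theorem trace_matrixRpow_half_sum_diag_le {I X K : Type*} [Fintype I] [Fintype X] [Fintype K]
    [DecidableEq I] [DecidableEq K] (C : Matrix (I × X) (I × K) ℂ) (D : Matrix X K ℂ)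
    (hD : ∀ x k, D x k = ∑ i, C (i, x) (i, k)) :
    (matrixRpow (Dᴴ * D) (1 / 2)).trace.re ≤ (matrixRpow (Cᴴ * C) (1 / 2)).trace.re := by
  obtain ⟨V, hV, hVD⟩ := exists_contraction_trace_eq D
  have hcontr : (1 - ((1 : Matrix I I ℂ) ⊗ₖ V)ᴴ * ((1 : Matrix I I ℂ) ⊗ₖ V)).PosSemidef := by
    have h := (PosSemidef.one (n := I) (R := ℂ)).kronecker hV
    have hsub : (1 : Matrix I I ℂ) ⊗ₖ (1 - Vᴴ * V) =
        1 - ((1 : Matrix I I ℂ) ⊗ₖ V)ᴴ * ((1 : Matrix I I ℂ) ⊗ₖ V) := by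
      rw [conjTranspose_kronecker, ← mul_kronecker_mul, conjTranspose_one, Matrix.one_mul,
        ← one_kronecker_one]
      ext p q
      simp only [kroneckerMap_apply, Matrix.sub_apply, mul_sub]
    rwa [hsub] at h
  have htr : (((1 : Matrix I I ℂ) ⊗ₖ V)ᴴ * C).trace = (Vᴴ * D).trace := by
    have hentry (i : I) (k : K) : (((1 : Matrix I I ℂ) ⊗ₖ V)ᴴ * C) (i, k) (i, k) =
        ∑ x, star (V x k) * C (i, x) (i, k) := by
      rw [Matrix.mul_apply, Fintype.sum_prod_type, Finset.sum_eq_single i]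
      · simp
      · intro i' _ hi
        simp [hi]
      · simp
    simp only [trace, diag_apply, Fintype.sum_prod_type, hentry, Matrix.mul_apply,
      conjTranspose_apply, hD, Finset.mul_sum]
    rw [Finset.sum_comm]
    exact Finset.sum_congr rfl fun k _ => Finset.sum_comm
  rw [← hVD, ← htr]
  exact re_trace_conjTranspose_mul_le C _ hcontr

/-- **Tracial Minkowski inequality for three spaces at `p = 2`:**
for a positive semidefinite `A` on `ℂ^I ⊗ ℂ^J ⊗ ℂ^K`,
`Tr ((Tr_J ((Tr₁ A)^2))^{1/2}) ≤ Tr ((Tr_J (A^2))^{1/2})`.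
Here the inner `ptraceFst` is the partial trace over `I` and the outer partial traces
are over `J`. -/
theorem trace_minkowski_three_factors_two {I J K : Type*}
    [Fintype I] [Fintype J] [Fintype K] [DecidableEq I] [DecidableEq J] [DecidableEq K]
    (A : Matrix (I × J × K) (I × J × K) ℂ) (hA : A.PosSemidef) :
    (matrixRpow (ptraceFst (matrixRpow (ptraceFst A) 2)) (1 / 2)).trace.re
      ≤ (matrixRpow (ptraceMid (matrixRpow A 2)) (1 / 2)).trace.re := by
  have hB : (ptraceFst A).IsHermitian := by
    ext p q
    simp only [ptraceFst, conjTranspose_apply, of_apply, star_sum]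
    exact Finset.sum_congr rfl fun i _ => hA.isHermitian.apply _ _
  let C : Matrix (I × J × J × K) (I × K) ℂ :=
    of fun x y => A (x.1, x.2.1, x.2.2.2) (y.1, x.2.2.1, y.2)
  let D : Matrix (J × J × K) K ℂ := of fun x k => ptraceFst A (x.1, x.2.2) (x.2.1, k)
  have hC : ptraceMid (matrixRpow A 2) = Cᴴ * C := by
    rw [matrixRpow_two hA.isHermitian]
    ext p q
    simp only [ptraceMid, of_apply, Matrix.mul_apply, conjTranspose_apply, C,
      Fintype.sum_prod_type]
    rw [Finset.sum_comm]
    refine Finset.sum_congr rfl fun i _ => ?_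
    rw [Finset.sum_comm]
  have hD : ptraceFst (matrixRpow (ptraceFst A) 2) = Dᴴ * D := by
    rw [matrixRpow_two hB]
    ext p q
    rw [ptraceFst]
    simp only [of_apply, Matrix.mul_apply, conjTranspose_apply, D,
      Fintype.sum_prod_type]
    rw [Finset.sum_comm]
  rw [hC, hD]
  exact trace_matrixRpow_half_sum_diag_le C D fun _ _ => rfl
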